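/- Let d ≥ 1, let p ∈ (1,∞), and let u : 𝕋^d → [0,∞) be a measurable function with 0 < |||u|||_{M¹} and |||u|||_{M^p} < ∞. Then u ∈ L¹(𝕋^d) and ‖u‖_{L¹(𝕋^d)} ≤ (p/(p−1)) · |||u|||_{M¹} · [1 + log( |||u|||_{M^p} / |||u|||_{M¹} )]. -/

import Mathlib

open MeasureTheory Filter
open scoped ENNReal

/-- The `d`-dimensional flat torus `𝕋^d = ℝ^d/ℤ^d`, with its Haar (Lebesgue) probability
measure given by `volume`. -/
abbrev Torus (d : ℕ) := Fin d → AddCircle (1 : ℝ)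

/-- The weak Lebesgue (Marcinkiewicz) quasinorm
`|||u|||_{M^p} = (sup_{λ>0} λ^p μ({|u| > λ}))^{1/p}`. -/
noncomputable def Mnorm {α : Type*} [MeasurableSpace α] (μ : Measure α) (p : ℝ)
    (u : α → ℝ) : ℝ≥0∞ :=
  (⨆ l : {l : ℝ // 0 < l}, ENNReal.ofReal (l : ℝ) ^ p * μ {x | (l : ℝ) < |u x|}) ^ (1 / p)

section WeakLebesgue

variable {α : Type*} [MeasurableSpace α] {μ : Measure α} {u : α → ℝ} {p : ℝ}

/-- Chebyshev's inequality for the weak Lebesgue quasinorm. -/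
lemma ofReal_rpow_mul_measure_le_Mnorm_rpow (hp : 0 < p) {t : ℝ} (ht : 0 < t) :
    ENNReal.ofReal t ^ p * μ {x | t < |u x|} ≤ Mnorm μ p u ^ p := by
  rw [Mnorm, ← ENNReal.rpow_mul, one_div_mul_cancel hp.ne', ENNReal.rpow_one]
  exact le_iSup (fun l : {l : ℝ // 0 < l} =>
    ENNReal.ofReal (l : ℝ) ^ p * μ {x | (l : ℝ) < |u x|}) ⟨t, ht⟩

lemma Mnorm_one_le_Mnorm [IsProbabilityMeasure μ] (hp : 1 ≤ p) :
    Mnorm μ 1 u ≤ Mnorm μ p u := by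
  have hp0 : 0 < p := zero_lt_one.trans_le hp
  rw [Mnorm, one_div_one, ENNReal.rpow_one]
  refine iSup_le fun ⟨t, ht⟩ => ?_
  rw [← ENNReal.rpow_le_rpow_iff hp0, ENNReal.rpow_one, ENNReal.mul_rpow_of_nonneg _ _ hp0.le]
  refine le_trans ?_ (ofReal_rpow_mul_measure_le_Mnorm_rpow hp0 ht)
  gcongr
  exact ENNReal.rpow_le_self_of_le_one prob_le_one hp

/-- The distribution function is bounded by `‖u‖_{M^p}^p t^{-p}`. -/
lemma measure_lt_abs_le_ofReal_rpow (hp : 0 < p) (hu : Mnorm μ p u ≠ ⊤) {t : ℝ} (ht : 0 < t) :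
    μ {x | t < |u x|} ≤ ENNReal.ofReal ((Mnorm μ p u).toReal ^ p * t ^ (-p)) := by
  have h := ofReal_rpow_mul_measure_le_Mnorm_rpow (μ := μ) (u := u) hp ht
  rw [← ENNReal.ofReal_toReal hu, ENNReal.ofReal_rpow_of_pos ht,
    ENNReal.ofReal_rpow_of_nonneg ENNReal.toReal_nonneg hp.le, mul_comm,
    ← ENNReal.le_div_iff_mul_le (.inl (by simpa using Real.rpow_pos_of_pos ht p))
      (.inl ENNReal.ofReal_ne_top),
    ← ENNReal.ofReal_div_of_pos (Real.rpow_pos_of_pos ht p)] at h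
  rwa [Real.rpow_neg ht.le, ← div_eq_mul_inv]

/-- Splitting the layer-cake integral at `a ≤ c`, with the distribution function bounded by
`1`, by `a / t` and by `b ^ p / t ^ p` respectively. -/
lemma lintegral_Ioi_le_of_le_one_of_le_inv_of_le_rpow {m : ℝ → ℝ≥0∞} {a b c : ℝ} (hp : 1 < p)
    (ha : 0 < a) (hb : 0 ≤ b) (hac : a ≤ c) (h0 : ∀ t, m t ≤ 1)
    (h1 : ∀ t, 0 < t → m t ≤ ENNReal.ofReal (a * t⁻¹))
    (h2 : ∀ t, 0 < t → m t ≤ ENNReal.ofReal (b ^ p * t ^ (-p))) :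
    ∫⁻ t in Set.Ioi 0, m t ≤
      ENNReal.ofReal (a + a * Real.log (c / a) + b ^ p * (c ^ (1 - p) / (p - 1))) := by
  have hc : 0 < c := ha.trans_le hac
  have hlog : 0 ≤ Real.log (c / a) := Real.log_nonneg ((one_le_div ha).2 hac)
  have hinv : IntegrableOn (fun t : ℝ => a * t⁻¹) (Set.Ioc a c) := by
    refine ((intervalIntegrable_iff_integrableOn_Ioc_of_le hac).1
      (intervalIntegrable_inv_iff.2 (Or.inr ?_))).const_mul a
    exact Set.notMem_uIcc_of_lt ha hc
  have htail : IntegrableOn (fun t : ℝ => b ^ p * t ^ (-p)) (Set.Ioi c) :=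
    (integrableOn_Ioi_rpow_of_lt (by linarith) hc).const_mul _
  have I0 : ∫⁻ t in Set.Ioc 0 a, m t ≤ ENNReal.ofReal a := by
    calc ∫⁻ t in Set.Ioc 0 a, m t ≤ ∫⁻ _ in Set.Ioc 0 a, 1 := lintegral_mono h0
      _ = ENNReal.ofReal a := by simp
  have I1 : ∫⁻ t in Set.Ioc a c, m t ≤ ENNReal.ofReal (a * Real.log (c / a)) := by
    calc ∫⁻ t in Set.Ioc a c, m t ≤ ∫⁻ t in Set.Ioc a c, ENNReal.ofReal (a * t⁻¹) :=
          setLIntegral_mono' measurableSet_Ioc fun t ht => h1 t (ha.trans ht.1)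
      _ = ENNReal.ofReal (∫ t in Set.Ioc a c, a * t⁻¹) := by
          refine (ofReal_integral_eq_lintegral_ofReal hinv ?_).symm
          refine (ae_restrict_iff' measurableSet_Ioc).2 (.of_forall fun t ht => ?_)
          have := ha.trans ht.1
          simp only [Pi.zero_apply]; positivity
      _ = ENNReal.ofReal (a * Real.log (c / a)) := by
          rw [← intervalIntegral.integral_of_le hac, intervalIntegral.integral_const_mul,
            integral_inv_of_pos ha hc]
  have I2 : ∫⁻ t in Set.Ioi c, m t ≤ ENNReal.ofReal (b ^ p * (c ^ (1 - p) / (p - 1))) := by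
    calc ∫⁻ t in Set.Ioi c, m t ≤ ∫⁻ t in Set.Ioi c, ENNReal.ofReal (b ^ p * t ^ (-p)) :=
          setLIntegral_mono' measurableSet_Ioi fun t ht => h2 t (hc.trans ht)
      _ = ENNReal.ofReal (∫ t in Set.Ioi c, b ^ p * t ^ (-p)) := by
          refine (ofReal_integral_eq_lintegral_ofReal htail ?_).symm
          refine (ae_restrict_iff' measurableSet_Ioi).2 (.of_forall fun t ht => ?_)
          have : 0 < t := hc.trans ht
          simp only [Pi.zero_apply]; positivity
      _ = ENNReal.ofReal (b ^ p * (c ^ (1 - p) / (p - 1))) := by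
          rw [integral_const_mul, integral_Ioi_rpow_of_lt (by linarith) hc,
            show -p + 1 = -(p - 1) by ring, neg_div_neg_eq, neg_sub]
  have hp1 : 0 < p - 1 := sub_pos.2 hp
  rw [ENNReal.ofReal_add (by positivity) (by positivity),
    ENNReal.ofReal_add ha.le (by positivity), ← Set.Ioc_union_Ioi_eq_Ioi hc.le,
    ← Set.Ioc_union_Ioc_eq_Ioc ha.le hac]
  exact (lintegral_union_le _ _ _).trans
    (add_le_add ((lintegral_union_le _ _ _).trans (add_le_add I0 I1)) I2)

/-- The value of the split integral at `c = a (b / a) ^ (p / (p - 1))`, where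
`a / c = b ^ p / c ^ p`. -/
lemma split_integral_value_eq {a b : ℝ} (hp : 1 < p) (ha : 0 < a) (hb : 0 < b) :
    a + a * Real.log (a * (b / a) ^ (p / (p - 1)) / a) +
        b ^ p * ((a * (b / a) ^ (p / (p - 1))) ^ (1 - p) / (p - 1)) =
      p / (p - 1) * a * (1 + Real.log (b / a)) := by
  have hp1 : p - 1 ≠ 0 := (sub_pos.2 hp).ne'
  have hba : 0 < b / a := div_pos hb ha
  have hc : (a * (b / a) ^ (p / (p - 1))) ^ (1 - p) = a * (b ^ p)⁻¹ := by
    rw [Real.mul_rpow ha.le (by positivity), ← Real.rpow_mul hba.le,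
      show p / (p - 1) * (1 - p) = -p by field_simp; ring, Real.rpow_neg hba.le,
      Real.div_rpow hb.le ha.le, Real.rpow_sub ha, Real.rpow_one]
    have := (Real.rpow_pos_of_pos ha p).ne'
    field_simp
  rw [mul_div_cancel_left₀ _ ha.ne', Real.log_rpow hba, hc]
  have := (Real.rpow_pos_of_pos hb p).ne'
  field_simp
  ring

/-- Interpolation between `M¹` and `M^p` on a probability space. -/
theorem lintegral_ofReal_le_Mnorm_one_mul_log [IsProbabilityMeasure μ] (hp : 1 < p)
    (hu : AEMeasurable u μ) (hu0 : ∀ x, 0 ≤ u x)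
    (hM1 : 0 < Mnorm μ 1 u) (hMp : Mnorm μ p u < ⊤) :
    ∫⁻ x, ENNReal.ofReal (u x) ∂μ ≤ ENNReal.ofReal
      ((p / (p - 1)) * (Mnorm μ 1 u).toReal *
        (1 + Real.log ((Mnorm μ p u).toReal / (Mnorm μ 1 u).toReal))) := by
  have hle : Mnorm μ 1 u ≤ Mnorm μ p u := Mnorm_one_le_Mnorm hp.le
  have hM1' : Mnorm μ 1 u ≠ ⊤ := (hle.trans_lt hMp).ne
  have ha : 0 < (Mnorm μ 1 u).toReal := ENNReal.toReal_pos hM1.ne' hM1'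
  have hab : (Mnorm μ 1 u).toReal ≤ (Mnorm μ p u).toReal := ENNReal.toReal_mono hMp.ne hle
  have hb := ha.trans_le hab
  have habs (t : ℝ) : {x | t < |u x|} = {x | t < u x} := by
    simp only [abs_of_nonneg (hu0 _)]
  rw [lintegral_eq_lintegral_meas_lt μ (.of_forall hu0) hu, ← split_integral_value_eq hp ha hb]
  refine lintegral_Ioi_le_of_le_one_of_le_inv_of_le_rpow hp ha hb.le ?_ (fun t => prob_le_one)
    (fun t ht => ?_) (fun t ht => ?_)
  · exact le_mul_of_one_le_right ha.le (Real.one_le_rpow ((one_le_div ha).2 hab)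
      (div_nonneg (by linarith) (by linarith)))
  · simpa [habs, Real.rpow_neg_one] using measure_lt_abs_le_ofReal_rpow zero_lt_one hM1' ht
  · simpa only [habs] using measure_lt_abs_le_ofReal_rpow (by linarith) hMp.ne ht

end WeakLebesgue

instance isProbabilityMeasure_volume_torus (d : ℕ) :
    IsProbabilityMeasure (volume : Measure (Torus d)) :=
  ⟨by simp [volume_pi, Measure.pi_univ]⟩

/-- Interpolation between `M¹` and `M^p`, `1 < p < ∞`: a non-negative measurable function
on `𝕋^d` with `0 < |||u|||_{M¹}` and `|||u|||_{M^p} < ∞` is in `L¹` and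
`‖u‖_{L¹} ≤ (p/(p-1)) |||u|||_{M¹} [1 + log(|||u|||_{M^p}/|||u|||_{M¹})]`. -/
theorem stmt3 (d : ℕ) (hd : 1 ≤ d) (p : ℝ) (hp : 1 < p) (u : Torus d → ℝ)
    (hu : Measurable u) (hu0 : ∀ x, 0 ≤ u x)
    (hM1 : 0 < Mnorm (volume : Measure (Torus d)) 1 u)
    (hMp : Mnorm (volume : Measure (Torus d)) p u < ⊤) :
    Integrable u (volume : Measure (Torus d)) ∧
      ∫ x, u x ∂(volume : Measure (Torus d)) ≤
        (p / (p - 1)) * (Mnorm (volume : Measure (Torus d)) 1 u).toReal *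
          (1 + Real.log ((Mnorm (volume : Measure (Torus d)) p u).toReal /
            (Mnorm (volume : Measure (Torus d)) 1 u).toReal)) := by
  have key := lintegral_ofReal_le_Mnorm_one_mul_log hp hu.aemeasurable hu0 hM1 hMp
  have hnn : 0 ≤ᵐ[volume] u := .of_forall hu0
  refine ⟨(lintegral_ofReal_ne_top_iff_integrable hu.aestronglyMeasurable hnn).1
    (key.trans_lt ENNReal.ofReal_lt_top).ne, ?_⟩
  rw [integral_eq_lintegral_of_nonneg_ae hnn hu.aestronglyMeasurable]
  refine ENNReal.toReal_le_of_le_ofReal ?_ key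
  have hle := Mnorm_one_le_Mnorm (μ := (volume : Measure (Torus d))) (u := u) hp.le
  have hlog := Real.log_nonneg ((one_le_div (ENNReal.toReal_pos hM1.ne' (hle.trans_lt hMp).ne)).2
    (ENNReal.toReal_mono hMp.ne hle))
  have hp1 : 0 < p - 1 := sub_pos.2 hp
  positivity
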